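/- Let p be a prime, a an integer with p ∤ a, α ≥ 0, and χ a Dirichlet character mod p^α. Set θ = 1 if p ≠ 3 and θ = 2 if p = 3. If t is an integer with t ≥ θ + max{θ, α}, and χ₀ denotes the principal character mod p^t, then C_{χχ₀}(a) = 0, where χχ₀ is the character mod p^t obtained by multiplying χ (lifted to modulus p^t) by χ₀. -/

import Mathlib

open scoped BigOperators

/-- `e(x) = exp(2πix)`. -/
noncomputable def e (x : ℝ) : ℂ := Complex.exp (2 * (Real.pi : ℂ) * Complex.I * (x : ℂ))

/-- The cubic character sum `C_ψ(a) = ∑_{k=1}^{q} ψ(k) e(a k³ / q)` for a Dirichlet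
character `ψ` mod `q`. -/
noncomputable def Cchi {q : ℕ} (ψ : DirichletCharacter ℂ q) (a : ℤ) : ℂ :=
  ∑ k ∈ Finset.Icc 1 q, ψ (k : ZMod q) * e ((a : ℝ) * (k : ℝ) ^ 3 / (q : ℝ))

/-- A sum over the representatives `1, …, q` of a function on `ZMod q`. -/
theorem sum_Icc_natCast_eq_sum_zmod {M : Type*} [AddCommMonoid M] {q : ℕ} [NeZero q]
    (f : ZMod q → M) : ∑ k ∈ Finset.Icc 1 q, f (k : ZMod q) = ∑ x, f x := by
  have hq : 0 < q := Nat.pos_of_neZero q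
  refine Finset.sum_bij (fun k _ => (k : ZMod q)) (fun _ _ => Finset.mem_univ _) ?_ ?_
    (fun _ _ => rfl)
  · intro k hk l hl hkl
    rw [Finset.mem_Icc] at hk hl
    have hdvd : (q : ℤ) ∣ (k : ℤ) - l := by
      rw [← ZMod.intCast_zmod_eq_zero_iff_dvd]
      push_cast
      exact sub_eq_zero.2 hkl
    have := Int.eq_zero_of_abs_lt_dvd hdvd (by rw [abs_lt]; omega)
    omega
  · intro x _
    by_cases hx : x = 0
    · exact ⟨q, Finset.mem_Icc.2 ⟨hq, le_rfl⟩, by simp [hx]⟩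
    · refine ⟨x.val, Finset.mem_Icc.2 ⟨?_, x.val_lt.le⟩, ZMod.natCast_zmod_val x⟩
      exact Nat.one_le_iff_ne_zero.2 ((ZMod.val_ne_zero x).2 hx)

/-- The cubic character sum in terms of the standard additive character of `ZMod q`. -/
theorem Cchi_eq_sum_stdAddChar {q : ℕ} [NeZero q] (ψ : DirichletCharacter ℂ q) (a : ℤ) :
    Cchi ψ a = ∑ x, ψ x * ZMod.stdAddChar ((a : ZMod q) * x ^ 3) := by
  rw [← sum_Icc_natCast_eq_sum_zmod, Cchi]
  refine Finset.sum_congr rfl fun k _ => ?_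
  have h : (a : ZMod q) * (k : ZMod q) ^ 3 = ((a * (k : ℤ) ^ 3 : ℤ) : ZMod q) := by push_cast; rfl
  rw [h, ZMod.stdAddChar_coe, e]
  push_cast
  congr 2
  ring

/-- The cubic character sum vanishes if `ψ` is periodic with respect to a square-zero `h`
such that `3 * h` is a nonzero `p`-torsion element. -/
theorem Cchi_eq_zero_of_periodic {q : ℕ} [NeZero q] (ψ : DirichletCharacter ℂ q) (a : ℤ)
    (ha : IsUnit (a : ZMod q)) (p : ℕ) (hp : p ≠ 0) (h : ZMod q) (h_sq : h ^ 2 = 0)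
    (h_three : 3 * h ≠ 0) (h_torsion : p * (3 * h) = 0)
    (hψ : ∀ (x : ZMod q) (v : ℕ), ψ (x + v * h) = ψ x) : Cchi ψ a = 0 := by
  rw [Cchi_eq_sum_stdAddChar]
  set F : ZMod q → ℂ := fun x => ψ x * ZMod.stdAddChar ((a : ZMod q) * x ^ 3) with hF
  have h_shift (x : ZMod q) (v : ℕ) :
      F (x + v * h) = F x * ZMod.stdAddChar ((a : ZMod q) * x ^ 2 * (3 * h)) ^ v := by
    have h_arg : (a : ZMod q) * (x + v * h) ^ 3 =
        a * x ^ 3 + v • ((a : ZMod q) * x ^ 2 * (3 * h)) := by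
      rw [nsmul_eq_mul]
      linear_combination (a : ZMod q) * (3 * x * v ^ 2 + v ^ 3 * h) * h_sq
    simp only [hF]
    rw [hψ, h_arg, AddChar.map_add_eq_mul, AddChar.map_nsmul_eq_pow, ← mul_assoc (ψ x)]
  have h_orbit (x : ZMod q) : ∑ v ∈ Finset.range p, F (x + v * h) = 0 := by
    simp_rw [h_shift, ← Finset.mul_sum]
    by_cases hx : IsUnit x
    · have h_ne : ZMod.stdAddChar ((a : ZMod q) * x ^ 2 * (3 * h)) ≠ 1 := by
        rw [← AddChar.map_zero_eq_one (ZMod.stdAddChar (N := q))]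
        refine ZMod.injective_stdAddChar.ne ?_
        rwa [Ne, (ha.mul (hx.pow 2)).mul_right_eq_zero]
      have h_pow : ZMod.stdAddChar ((a : ZMod q) * x ^ 2 * (3 * h)) ^ p = 1 := by
        rw [← AddChar.map_nsmul_eq_pow, nsmul_eq_mul, mul_left_comm, h_torsion, mul_zero,
          AddChar.map_zero_eq_one]
      rw [geom_sum_eq h_ne, h_pow, sub_self, zero_div, mul_zero]
    · simp [hF, ψ.map_nonunit hx]
  have h_total : (p : ℂ) * ∑ x, F x = 0 := by
    calc (p : ℂ) * ∑ x, F x = ∑ v ∈ Finset.range p, ∑ x, F (x + v * h) := by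
          have h_inv (v : ℕ) : ∑ x, F (x + v * h) = ∑ x, F x :=
            Equiv.sum_comp (Equiv.addRight ((v : ZMod q) * h)) F
          simp [h_inv]
      _ = 0 := by
          rw [Finset.sum_comm]
          exact Finset.sum_eq_zero fun x _ => h_orbit x
  exact (mul_eq_zero.1 h_total).resolve_left (Nat.cast_ne_zero.2 hp)

/-- A character induced from modulus `m` is invariant under translation by a nilpotent
element vanishing modulo `m`. -/
theorem changeLevel_add_of_castHom_eq_zero {m q : ℕ} (hmq : m ∣ q) (χ : DirichletCharacter ℂ m)
    (x y : ZMod q) (hy : IsNilpotent y) (hy_zero : ZMod.castHom hmq (ZMod m) y = 0) :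
    DirichletCharacter.changeLevel hmq χ (x + y) = DirichletCharacter.changeLevel hmq χ x := by
  by_cases hx : IsUnit x
  · have hxy : IsUnit (x + y) := hy.isUnit_add_left_of_commute hx (Commute.all _ _)
    obtain ⟨u, rfl⟩ := hx
    obtain ⟨w, hw⟩ := hxy
    rw [← hw, DirichletCharacter.changeLevel_eq_cast_of_dvd,
      DirichletCharacter.changeLevel_eq_cast_of_dvd, hw]
    simp only [← ZMod.castHom_apply (R := ZMod m) (h := hmq)]
    rw [map_add, hy_zero, add_zero]
  · have hxy : ¬ IsUnit (x + y) := fun hu => hx <| by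
      simpa using hy.neg.isUnit_add_left_of_commute hu (Commute.all _ _)
    rw [MulChar.map_nonunit _ hx, MulChar.map_nonunit _ hxy]

/-- Let `p` be a prime, `p ∤ a`, and `χ` a Dirichlet character mod `p^α`.  Put
`θ = 1` if `p ≠ 3` and `θ = 2` if `p = 3`.  If `t ≥ θ + max{θ, α}` then
`C_{χχ₀}(a) = 0`, where `χχ₀` is `χ` lifted to modulus `p^t` times the principal
character `χ₀` mod `p^t`. -/
theorem Cchi_mul_principal_eq_zero (p : ℕ) (hp : p.Prime) (α : ℕ)
    (χ : DirichletCharacter ℂ (p ^ α)) (a : ℤ) (hpa : ¬ (p : ℤ) ∣ a)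
    (t : ℕ) (ht : (if p = 3 then 2 else 1) + max (if p = 3 then 2 else 1) α ≤ t) :
    Cchi
      ((DirichletCharacter.changeLevel
          (pow_dvd_pow p
            ((le_max_right (if p = 3 then 2 else 1) α).trans
              ((Nat.le_add_left _ _).trans ht))) χ) * (1 : DirichletCharacter ℂ (p ^ t)))
      a = 0 := by
  set θ : ℕ := if p = 3 then 2 else 1 with hθ
  have hθ_le : θ + θ ≤ t := le_trans (by gcongr; exact le_max_left _ _) ht
  have hα_le : θ + α ≤ t := le_trans (by gcongr; exact le_max_right _ _) ht
  have hθ_pos : 1 ≤ θ := by rw [hθ]; split_ifs <;> norm_num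
  have : NeZero (p ^ t) := ⟨pow_ne_zero t hp.ne_zero⟩
  have ha : IsUnit (a : ZMod (p ^ t)) := by
    have h_coprime : IsCoprime a ((p ^ t : ℕ) : ℤ) := by
      push_cast
      exact ((Nat.prime_iff_prime_int.1 hp).coprime_iff_not_dvd.2 hpa).symm.pow_right
    exact (ZMod.coe_int_isUnit_iff_isCoprime a (p ^ t)).2 h_coprime.symm
  have h_sq : ((p ^ (t - θ) : ℕ) : ZMod (p ^ t)) ^ 2 = 0 := by
    rw [← Nat.cast_pow, ZMod.natCast_eq_zero_iff, ← pow_mul]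
    exact pow_dvd_pow p (by omega)
  rw [mul_one]
  refine Cchi_eq_zero_of_periodic _ a ha p hp.ne_zero ((p ^ (t - θ) : ℕ) : ZMod (p ^ t)) h_sq
    ?_ ?_ fun x v => changeLevel_add_of_castHom_eq_zero _ χ x _ ?_ ?_
  · intro h_zero
    have h_dvd : p ^ t ∣ 3 * p ^ (t - θ) := by
      rw [← ZMod.natCast_eq_zero_iff]
      exact_mod_cast h_zero
    rw [← Nat.sub_add_cancel (show θ ≤ t by omega), Nat.add_sub_cancel, pow_add, mul_comm 3,
      Nat.mul_dvd_mul_iff_left (pow_pos hp.pos _)] at h_dvd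
    by_cases h3 : p = 3
    · rw [hθ, if_pos h3, h3] at h_dvd
      norm_num at h_dvd
    · rw [hθ, if_neg h3, pow_one] at h_dvd
      exact h3 ((Nat.prime_dvd_prime_iff_eq hp Nat.prime_three).1 h_dvd)
  · have h_dvd : p ^ θ ∣ p * 3 := by
      rw [hθ]
      split_ifs with h3
      · rw [h3]; norm_num
      · simp
    have h_dvd' : p ^ t ∣ p * (3 * p ^ (t - θ)) := by
      rw [← mul_assoc]
      calc p ^ t = p ^ θ * p ^ (t - θ) := by rw [← pow_add, Nat.add_sub_cancel' (by omega)]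
        _ ∣ _ := Nat.mul_dvd_mul_right h_dvd _
    rw [← ZMod.natCast_eq_zero_iff] at h_dvd'
    exact_mod_cast h_dvd'
  · exact ⟨2, by rw [mul_pow, h_sq, mul_zero]⟩
  · rw [map_mul, map_natCast, map_natCast,
      (ZMod.natCast_eq_zero_iff (p ^ (t - θ)) (p ^ α)).2 (pow_dvd_pow p (by omega)), mul_zero]
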